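/- Appendix B corollary (higher syzygies of the ∇̃-equation): let ε > 0, let g : ℂ → ℂ be holomorphic on the annulus A_ε and not identically zero on A_ε, let n ≥ 1 and M ≤ N with M ≥ 1, and let F : (Fin n → Fin M) → ((Fin N → ℂ) → ℂ) be a family of functions, each holomorphic on A_ε^N, which is alternating in its index slots (F changes sign whenever two of the n indices are transposed, and vanishes when two indices coincide), such that for every fixed a : Fin n → Fin M and every way of replacing its first slot, ∑_{b : Fin M} F (a with first slot replaced by b) z * g (z b) = 0 for all z ∈ A_ε^N. Then there exists an alternating family G : (Fin (n+1) → Fin M) → ((Fin N → ℂ) → ℂ), each member holomorphic on A_ε^N, such that F a z = ∑_{b : Fin M} G (a extended by b in the last slot) z * g (z b) for all a and z ∈ A_ε^N. -/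

import Mathlib

open Finset

/-- The annulus `A_ε = {z : ℂ | 1 − ε < ‖z‖ < 1 + ε}` around the unit circle. -/
def annulus (ε : ℝ) : Set ℂ := {z : ℂ | 1 - ε < ‖z‖ ∧ ‖z‖ < 1 + ε}

/-- The polyannulus `A_ε^N = {z : Fin N → ℂ | ∀ i, z i ∈ A_ε}`. -/
def polyAnnulus (ε : ℝ) (N : ℕ) : Set (Fin N → ℂ) := {z | ∀ i, z i ∈ annulus ε}


lemma fderiv_bd {E : Type*} [NormedAddCommGroup E] [NormedSpace ℂ E] {f : E → ℂ} {x : E} {r C : ℝ}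
    (hr : 0 < r) (hd : DifferentiableOn ℂ f (Metric.ball x r))
    (hC : ∀ y ∈ Metric.ball x r, ‖f y‖ ≤ C) : ‖fderiv ℂ f x‖ ≤ 2 * C / r := by
  refine Complex.norm_fderiv_le_div_of_mapsTo_ball hd (fun y hy => ?_) hr
  rw [Metric.mem_closedBall, dist_eq_norm]
  have h1 := hC y hy
  have h2 := hC x (Metric.mem_ball_self hr)
  have := norm_sub_le (f y) (f x)
  linarith

lemma diff_circle {N : ℕ} {Ψ : (Fin N → ℂ) × ℂ → ℂ} {W : Set ((Fin N → ℂ) × ℂ)} (hW : IsOpen W)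
    (hΨ : DifferentiableOn ℂ Ψ W) {x₀ : Fin N → ℂ} {w : ℂ} {r : ℝ} (hr : 0 < r)
    (hs : ∀ ζ ∈ Metric.sphere w r, (x₀, ζ) ∈ W) :
    DifferentiableAt ℂ (fun x => circleIntegral (fun ζ => Ψ (x, ζ)) w r) x₀ := by
  have hsub : ({x₀} : Set (Fin N → ℂ)) ×ˢ Metric.sphere w r ⊆ W := by
    rintro ⟨x, ζ⟩ ⟨hx, hζ⟩
    have hx' : x = x₀ := hx
    rw [hx']
    exact hs ζ hζ
  obtain ⟨u, v, hu, hv, hxu, hsv, huv⟩ :=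
    generalized_tube_lemma isCompact_singleton (isCompact_sphere w r) hW hsub
  obtain ⟨δ', hδ', hball⟩ := Metric.isOpen_iff.1 hu x₀ (hxu rfl)
  obtain ⟨δ, hδ, hδδ⟩ : ∃ δ > 0, 2 * δ < δ' := ⟨δ' / 3, by positivity, by linarith⟩
  have hcb : Metric.closedBall x₀ (2 * δ) ×ˢ Metric.sphere w r ⊆ W := by
    rintro ⟨x, ζ⟩ ⟨hx, hζ⟩
    exact huv ⟨hball (Metric.closedBall_subset_ball hδδ hx), hsv hζ⟩
  obtain ⟨C, hC⟩ := ((isCompact_closedBall x₀ (2 * δ)).prod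
    (isCompact_sphere w r)).exists_bound_of_continuousOn (hΨ.continuousOn.mono hcb)
  have hcm : ∀ θ, circleMap w r θ ∈ Metric.sphere w r := fun θ => circleMap_mem_sphere _ hr.le θ
  have hslice : ∀ θ : ℝ, ∀ x ∈ Metric.closedBall x₀ (2 * δ),
      HasFDerivAt (fun x => Ψ (x, circleMap w r θ))
        ((fderiv ℂ Ψ (x, circleMap w r θ)).comp (ContinuousLinearMap.inl ℂ _ ℂ)) x := by
    intro θ x hx
    have h1 : HasFDerivAt Ψ (fderiv ℂ Ψ (x, circleMap w r θ)) (x, circleMap w r θ) :=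
      (hΨ.differentiableAt (hW.mem_nhds (hcb ⟨hx, hcm θ⟩))).hasFDerivAt
    exact h1.comp x (hasFDerivAt_prodMk_left x _)
  have hdc : deriv (circleMap w r) = fun θ => circleMap 0 r θ * Complex.I :=
    funext fun θ => deriv_circleMap w r θ
  have hcont : ∀ x ∈ Metric.closedBall x₀ (2 * δ),
      Continuous fun θ => deriv (circleMap w r) θ • Ψ (x, circleMap w r θ) := by
    intro x hx
    refine Continuous.fun_smul ?_ ?_
    · rw [hdc]; fun_prop
    · have : ContinuousOn Ψ W := hΨ.continuousOn
      refine this.comp_continuous (by fun_prop) (fun θ => hcb ⟨hx, hcm θ⟩)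
  have key := intervalIntegral.hasFDerivAt_integral_of_dominated_of_fderiv_le
    (μ := MeasureTheory.volume) (𝕜 := ℂ)
    (a := 0) (b := 2 * Real.pi) (s := Metric.ball x₀ δ) (x₀ := x₀)
    (bound := fun _ => r * (2 * C / δ))
    (F := fun x θ => deriv (circleMap w r) θ • Ψ (x, circleMap w r θ))
    (F' := fun x θ => deriv (circleMap w r) θ •
      (fderiv ℂ Ψ (x, circleMap w r θ)).comp (ContinuousLinearMap.inl ℂ _ ℂ))
    (Metric.ball_mem_nhds _ hδ) ?_ ?_ ?_ ?_ ?_ ?_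
  · exact key.differentiableAt
  · filter_upwards [Metric.closedBall_mem_nhds x₀ (by positivity : 0 < 2 * δ)] with x hx
    exact (hcont x hx).aestronglyMeasurable
  · exact (hcont x₀ (Metric.mem_closedBall_self (by positivity))).intervalIntegrable _ _
  · refine Measurable.aestronglyMeasurable ?_
    refine Measurable.fun_smul ?_ ?_
    · rw [hdc]; fun_prop
    · have h1 : Measurable (fun θ => fderiv ℂ Ψ (x₀, circleMap w r θ)) :=
        (measurable_fderiv ℂ Ψ).comp (by fun_prop)
      have h2 : Continuous fun L : ((Fin N → ℂ) × ℂ →L[ℂ] ℂ) =>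
        L.comp (ContinuousLinearMap.inl ℂ (Fin N → ℂ) ℂ) := by fun_prop
      exact h2.measurable.comp h1
  · refine Filter.Eventually.of_forall fun θ _ x hx => ?_
    rw [norm_smul]
    have h1 : ‖deriv (circleMap w r) θ‖ = r := by
      simp [deriv_circleMap, abs_of_pos hr]
    rw [h1]
    have hx2 : x ∈ Metric.closedBall x₀ (2 * δ) :=
      Metric.ball_subset_closedBall (Metric.ball_subset_ball (by linarith) hx)
    rw [← (hslice θ x hx2).fderiv]
    have hsubb : Metric.ball x δ ⊆ Metric.closedBall x₀ (2 * δ) := by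
      intro y hy
      rw [Metric.mem_ball] at hx hy
      rw [Metric.mem_closedBall]
      have := dist_triangle y x x₀
      linarith
    refine mul_le_mul_of_nonneg_left (fderiv_bd hδ (fun y hy =>
      (hslice θ y (hsubb hy)).differentiableAt.differentiableWithinAt) (fun y hy => ?_)) hr.le
    exact hC _ ⟨hsubb hy, hcm θ⟩
  · exact intervalIntegrable_const
  · refine Filter.Eventually.of_forall fun θ _ x hx => ?_
    have hx2 : x ∈ Metric.closedBall x₀ (2 * δ) :=
      Metric.ball_subset_closedBall (Metric.ball_subset_ball (by linarith) hx)
    exact (hslice θ x hx2).fun_const_smul _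

lemma diff_tsum {E ι : Type*} [NormedAddCommGroup E] [NormedSpace ℂ E] {t : ι → E → ℂ} {x₀ : E}
    {r : ℝ} (hr : 0 < r) {b : ι → ℝ} (hb : Summable b)
    (hd : ∀ i, DifferentiableOn ℂ (t i) (Metric.ball x₀ r))
    (hbd : ∀ i, ∀ x ∈ Metric.ball x₀ r, ‖t i x‖ ≤ b i) :
    DifferentiableAt ℂ (fun x => ∑' i, t i x) x₀ := by
  let _ : NormedSpace ℝ E := NormedSpace.restrictScalars ℝ ℂ E
  have hsubb : ∀ x ∈ Metric.ball x₀ (r / 2), Metric.ball x (r / 2) ⊆ Metric.ball x₀ r := by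
    intro x hx y hy
    rw [Metric.mem_ball] at *
    have := dist_triangle y x x₀
    linarith
  have := hasFDerivAt_tsum_of_isPreconnected (𝕜 := ℂ) (f := t) (f' := fun i x => fderiv ℂ (t i) x)
    (u := fun i => 2 * b i / (r / 2)) (s := Metric.ball x₀ (r / 2)) (x₀ := x₀) (x := x₀)
    ((hb.mul_left 2).div_const _) Metric.isOpen_ball (convex_ball _ _).isPreconnected
    (fun i x hx => ((hd i).differentiableAt (Metric.isOpen_ball.mem_nhds
      (Metric.ball_subset_ball (by linarith) hx))).hasFDerivAt)
    (fun i x hx => fderiv_bd (by positivity) ((hd i).mono (hsubb x hx))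
      (fun y hy => hbd i y (hsubb x hx hy)))
    (Metric.mem_ball_self (by positivity))
    (Summable.of_norm_bounded hb (fun i => hbd i x₀ (Metric.mem_ball_self hr)))
    (Metric.mem_ball_self (by positivity))
  exact this.differentiableAt

/-- product domain -/
def pA (A : Set ℂ) (N : ℕ) : Set (Fin N → ℂ) := {z | ∀ i, z i ∈ A}

lemma pA_open {A : Set ℂ} (hA : IsOpen A) (N : ℕ) : IsOpen (pA A N) := by
  have : pA A N = ⋂ i, (fun z : Fin N → ℂ => z i) ⁻¹' A := by ext; simp [pA]
  rw [this]
  exact isOpen_iInter_of_finite fun i => hA.preimage (continuous_apply i)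

lemma pA_update {A : Set ℂ} {N : ℕ} {z : Fin N → ℂ} (hz : z ∈ pA A N) (k : Fin N) {w : ℂ}
    (hw : w ∈ A) : Function.update z k w ∈ pA A N := by
  intro i
  by_cases h : i = k
  · subst h; simpa using hw
  · simpa [h] using hz i

lemma diff_update {N : ℕ} (k : Fin N) :
    Differentiable ℂ (fun p : (Fin N → ℂ) × ℂ => Function.update p.1 k p.2) := by
  rw [differentiable_pi]
  intro i
  by_cases h : i = k
  · subst h; simp only [Function.update_self]; fun_prop
  · simp only [Function.update_of_ne h]; fun_prop

lemma diff_dslope {A : Set ℂ} (hA : IsOpen A) {N : ℕ} {f : (Fin N → ℂ) → ℂ}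
    (hf : DifferentiableOn ℂ f (pA A N)) (k : Fin N) {w : ℂ} (hw : w ∈ A)
    (h0 : ∀ z ∈ pA A N, z k = w → f z = 0) :
    ∃ q : (Fin N → ℂ) → ℂ, DifferentiableOn ℂ q (pA A N) ∧
      ∀ z ∈ pA A N, f z = (z k - w) * q z := by
  have hop := pA_open hA N
  have hφ : ∀ z ∈ pA A N, DifferentiableOn ℂ (fun t => f (Function.update z k t)) A := by
    intro z hz
    refine hf.comp (Differentiable.differentiableOn ?_) (fun t ht => pA_update hz k ht)
    exact (diff_update k).comp (by fun_prop : Differentiable ℂ fun t : ℂ => (z, t))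
  have hφ0 : ∀ z ∈ pA A N, f (Function.update z k w) = 0 := fun z hz =>
    h0 _ (pA_update hz k hw) (by simp)
  let q : (Fin N → ℂ) → ℂ := fun z => dslope (fun t => f (Function.update z k t)) w (z k)
  have hq : ∀ z ∈ pA A N, f z = (z k - w) * q z := by
    intro z hz
    have := sub_smul_dslope (fun t => f (Function.update z k t)) w (z k)
    simp only [Function.update_eq_self, hφ0 z hz, sub_zero, smul_eq_mul] at this
    exact this.symm
  refine ⟨q, fun z₀ hz₀ => DifferentiableAt.differentiableWithinAt ?_, hq⟩
  by_cases hk : z₀ k = w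
  · obtain ⟨r', hr', hrA'⟩ := Metric.isOpen_iff.1 hA w hw
    obtain ⟨r, hr, hrr⟩ : ∃ r > 0, r < r' := ⟨r' / 2, by positivity, by linarith⟩
    have hrA : Metric.closedBall w r ⊆ A := (Metric.closedBall_subset_ball hrr).trans hrA'
    let Ψ : (Fin N → ℂ) × ℂ → ℂ := fun p =>
      (p.2 - p.1 k)⁻¹ * ((p.2 - w)⁻¹ * f (Function.update p.1 k p.2))
    let W : Set ((Fin N → ℂ) × ℂ) :=
      {p | p.1 ∈ pA A N ∧ p.2 ∈ A ∧ p.2 - p.1 k ≠ 0 ∧ p.2 - w ≠ 0}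
    have hW : IsOpen W := by
      refine (hop.preimage continuous_fst).inter ((hA.preimage continuous_snd).inter
        (IsOpen.inter ?_ ?_))
      · exact isOpen_ne_fun (by fun_prop) (by fun_prop)
      · exact isOpen_ne_fun (by fun_prop) (by fun_prop)
    have hΨ : DifferentiableOn ℂ Ψ W := by
      refine DifferentiableOn.mul (DifferentiableOn.inv (by fun_prop) fun p hp => hp.2.2.1)
        (DifferentiableOn.mul (DifferentiableOn.inv (by fun_prop) fun p hp => hp.2.2.2) ?_)
      exact hf.comp (diff_update k).differentiableOn (fun p hp => pA_update hp.1 k hp.2.1)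
    have hsph : ∀ ζ ∈ Metric.sphere w r, ζ - w ≠ 0 := by
      intro ζ hζ h
      rw [sub_eq_zero] at h
      subst h
      simp at hζ; exact hr.ne hζ
    have hd := diff_circle hW hΨ hr (x₀ := z₀) (w := w) (fun ζ hζ => ⟨hz₀,
      hrA (Metric.sphere_subset_closedBall hζ), by
        show ζ - z₀ k ≠ 0
        rw [hk]; exact hsph ζ hζ, hsph ζ hζ⟩)
    have hev : q =ᶠ[nhds z₀] fun z =>
        (2 * Real.pi * Complex.I : ℂ)⁻¹ * circleIntegral (fun ζ => Ψ (z, ζ)) w r := by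
      have hb : ∀ᶠ z : Fin N → ℂ in nhds z₀, z k ∈ Metric.ball w r := by
        refine (continuous_apply k).continuousAt.eventually_mem ?_
        rw [hk]; exact Metric.ball_mem_nhds _ hr
      filter_upwards [hop.mem_nhds hz₀, hb] with z hz hzb
      have hds : DifferentiableOn ℂ (dslope (fun t => f (Function.update z k t)) w)
          (Metric.closedBall w r) :=
        ((Complex.differentiableOn_dslope (hA.mem_nhds hw)).2 (hφ z hz)).mono hrA
      have hC := hds.circleIntegral_sub_inv_smul hzb
      have hcongr : circleIntegral (fun ζ => Ψ (z, ζ)) w r = circleIntegral (fun ζ =>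
          (ζ - z k)⁻¹ • dslope (fun t => f (Function.update z k t)) w ζ) w r := by
        refine circleIntegral.integral_congr hr.le fun ζ hζ => ?_
        have : ζ ≠ w := sub_ne_zero.1 (hsph ζ hζ)
        simp only [Ψ, smul_eq_mul, dslope_of_ne _ this, slope_def_field, hφ0 z hz]
        rw [sub_zero, div_eq_inv_mul]
      rw [hcongr, hC, smul_eq_mul, ← mul_assoc, inv_mul_cancel₀, one_mul]
      simp [Real.pi_ne_zero]
    exact (hd.const_mul _).congr_of_eventuallyEq hev
  · have hev : q =ᶠ[nhds z₀] fun z => f z / (z k - w) := by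
      have hb : ∀ᶠ z : Fin N → ℂ in nhds z₀, z k ≠ w :=
        (continuous_apply k).continuousAt.eventually_ne hk
      filter_upwards [hop.mem_nhds hz₀, hb] with z hz hzb
      rw [hq z hz]
      field_simp [sub_ne_zero.2 hzb]
    refine DifferentiableAt.congr_of_eventuallyEq ?_ hev
    simp only [div_eq_mul_inv]
    exact (hf.differentiableAt (hop.mem_nhds hz₀)).fun_mul
      (DifferentiableAt.fun_inv (by fun_prop) (sub_ne_zero.2 hk))

/-- sign -/
def ksg (b : ℕ) (S : Finset ℕ) : ℤ := ∏ s ∈ S, Int.sign ((b : ℤ) - (s : ℤ))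

lemma ksg_mem {b : ℕ} {S : Finset ℕ} (h : b ∈ S) : ksg b S = 0 := by
  unfold ksg
  exact Finset.prod_eq_zero h (by simp)

lemma ksg_insert {b c : ℕ} {S : Finset ℕ} (h : b ∉ S) :
    ksg c (insert b S) = Int.sign ((c : ℤ) - b) * ksg c S := by
  unfold ksg
  rw [Finset.prod_insert h]

lemma ksg_mul (b c : ℕ) (S : Finset ℕ) :
    ksg b S * ksg c (insert b S) = Int.sign ((c : ℤ) - b) * (ksg b S * ksg c S) := by
  by_cases h : b ∈ S
  · simp [ksg_mem h]
  · rw [ksg_insert h]; ring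

lemma ksg_top {m : ℕ} {S : Finset ℕ} (h : S ⊆ range m) : ksg m S = 1 := by
  unfold ksg
  refine Finset.prod_eq_one fun s hs => ?_
  have := Finset.mem_range.1 (h hs)
  exact Int.sign_eq_one_of_pos (by omega)

section
variable {R : Type*} [CommRing R]

/-- contraction -/
def kio (g : ℕ → R) (m : ℕ) (F : Finset ℕ → R) (S : Finset ℕ) : R :=
  ∑ b ∈ range m, (ksg b S : R) * F (insert b S) * g b

lemma kio_sub (g : ℕ → R) (m : ℕ) (F H : Finset ℕ → R) (S : Finset ℕ) :
    kio g m (fun S => F S - H S) S = kio g m F S - kio g m H S := by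
  simp only [kio, ← Finset.sum_sub_distrib]
  exact Finset.sum_congr rfl fun _ _ => by ring

lemma kio_add (g : ℕ → R) (m : ℕ) (F H : Finset ℕ → R) (S : Finset ℕ) :
    kio g m (fun S => F S + H S) S = kio g m F S + kio g m H S := by
  simp only [kio, ← Finset.sum_add_distrib]
  exact Finset.sum_congr rfl fun _ _ => by ring

lemma kio_mul (g : ℕ → R) (m : ℕ) (x : R) (F : Finset ℕ → R) (S : Finset ℕ) :
    kio g m (fun S => x * F S) S = x * kio g m F S := by
  simp only [kio, Finset.mul_sum]
  exact Finset.sum_congr rfl fun _ _ => by ring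

lemma kio_congr (g : ℕ → R) {m : ℕ} {F H : Finset ℕ → R} {S : Finset ℕ}
    (hS : S ⊆ range m) (h : ∀ S ⊆ range m, F S = H S) :
    kio g m F S = kio g m H S := by
  simp only [kio]
  refine Finset.sum_congr rfl fun b hb => ?_
  rw [h (insert b S) (Finset.insert_subset hb hS)]

lemma kio_map (J : R →+* R) (g : ℕ → R) (m : ℕ) (hJ : ∀ i < m, J (g i) = g i)
    (F : Finset ℕ → R) (S : Finset ℕ) :
    kio g m (fun S => J (F S)) S = J (kio g m F S) := by
  simp only [kio, map_sum]
  refine Finset.sum_congr rfl fun b hb => ?_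
  simp [hJ b (Finset.mem_range.1 hb)]

lemma kio_empty (g : ℕ → R) (m : ℕ) (F : Finset ℕ → R) (h : ∀ b, F {b} = 0) :
    kio g m F ∅ = 0 := by
  simp only [kio]
  refine Finset.sum_eq_zero fun b _ => ?_
  simp [h]

lemma kio_kio (h2 : ∀ x : R, x + x = 0 → x = 0) (g : ℕ → R) (m : ℕ) (F : Finset ℕ → R)
    (S : Finset ℕ) : kio g m (kio g m F) S = 0 := by
  have key : kio g m (kio g m F) S = ∑ b ∈ range m, ∑ c ∈ range m,
      ((Int.sign ((c : ℤ) - b) * (ksg b S * ksg c S) : ℤ) : R) *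
        F (insert c (insert b S)) * (g b * g c) := by
    simp only [kio, Finset.mul_sum, Finset.sum_mul]
    refine Finset.sum_congr rfl fun b _ => Finset.sum_congr rfl fun c _ => ?_
    rw [← ksg_mul]
    push_cast
    ring
  apply h2
  nth_rewrite 1 [key]
  rw [Finset.sum_comm, key, ← Finset.sum_add_distrib]
  refine Finset.sum_eq_zero fun b _ => ?_
  rw [← Finset.sum_add_distrib]
  refine Finset.sum_eq_zero fun c _ => ?_
  have : Int.sign ((b : ℤ) - c) = - Int.sign ((c : ℤ) - b) := by
    rw [← Int.sign_neg]; congr 1; ring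
  rw [this, Finset.insert_comm]
  push_cast
  ring

lemma kio_succ (g : ℕ → R) (m : ℕ) (F : Finset ℕ → R) (S : Finset ℕ) (hS : S ⊆ range m) :
    kio g (m + 1) F S = kio g m F S + g m * F (insert m S) := by
  simp only [kio, Finset.sum_range_succ, ksg_top hS]
  push_cast; ring

lemma kio_succ_insert (g : ℕ → R) (m : ℕ) (F : Finset ℕ → R) (S : Finset ℕ) (hS : S ⊆ range m) :
    kio g (m + 1) F (insert m S) = - kio g m (fun S => F (insert m S)) S := by
  have hm : m ∉ S := fun h => by simpa using hS h
  simp only [kio, Finset.sum_range_succ, ksg_mem (Finset.mem_insert_self m S),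
    ← Finset.sum_neg_distrib]
  rw [Int.cast_zero, zero_mul, zero_mul, add_zero]
  refine Finset.sum_congr rfl fun b hb => ?_
  have hb := Finset.mem_range.1 hb
  rw [ksg_insert hm, Int.sign_eq_neg_one_of_neg (by omega), Finset.insert_comm]
  push_cast; ring

/-- exactness property -/
def KEx (g : ℕ → R) (m : ℕ) : Prop :=
  ∀ F : Finset ℕ → R, F ∅ = 0 → (∀ S ⊆ range m, kio g m F S = 0) →
    ∃ G : Finset ℕ → R, (∀ b, G {b} = 0) ∧ ∀ S ⊆ range m, F S = kio g m G S

lemma kex_dev (h2 : ∀ x : R, x + x = 0 → x = 0) (g : ℕ → R) (m : ℕ) (hP : KEx g m)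
    (x : R) (hx : ∀ y, x * y = 0 → y = 0) (J : R →+* R) (hJx : J x = 0)
    (hJ : ∀ i < m, J (g i) = g i) (hd : ∀ f, x ∣ f - J f) (k : ℕ) :
    ∀ F : Finset ℕ → R, F ∅ = 0 → (∀ S ⊆ range m, x ^ k ∣ kio g m F S) →
    ∃ H : Finset ℕ → R, (∀ b, H {b} = 0) ∧ ∀ S ⊆ range m, x ^ k ∣ F S - kio g m H S := by
  induction k with
  | zero => intro F _ _; exact ⟨fun _ => 0, by simp, by simp⟩
  | succ k ih =>
    intro F hF0 hF
    obtain ⟨h, hb, hh⟩ := hP (fun S => J (F S)) (by simp [hF0]) (fun S hS => by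
      rw [kio_map J g m hJ]
      obtain ⟨y, hy⟩ := hF S hS
      rw [hy, map_mul, map_pow, hJx, pow_succ]; simp)
    have hdiv : ∀ S, ∃ y, S ⊆ range m → F S - kio g m h S = x * y := by
      intro S
      by_cases hS : S ⊆ range m
      · obtain ⟨y, hy⟩ := hd (F S)
        exact ⟨y, fun _ => by rw [← hh S hS, hy]⟩
      · exact ⟨0, fun h => absurd h hS⟩
    choose F1 hF1 using hdiv
    have hF10 : F1 ∅ = 0 := by
      apply hx
      rw [← hF1 ∅ (by simp), hF0, kio_empty g m h hb, sub_zero]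
    obtain ⟨H1, hb1, hH1⟩ := ih F1 hF10 (fun S hS => by
      obtain ⟨y, hy⟩ := hF S hS
      refine ⟨y, ?_⟩
      have e : x * kio g m F1 S = x ^ (k + 1) * y := by
        rw [← kio_mul, ← hy, ← kio_congr g hS hF1, kio_sub, kio_kio h2, sub_zero]
      have : x * (kio g m F1 S - x ^ k * y) = 0 := by rw [mul_sub, e]; ring
      exact sub_eq_zero.1 (hx _ this))
    refine ⟨fun S => h S + x * H1 S, fun b => by simp [hb, hb1], fun S hS => ?_⟩
    obtain ⟨y, hy⟩ := hH1 S hS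
    refine ⟨y, ?_⟩
    rw [kio_add, kio_mul, ← sub_sub, hF1 S hS, ← mul_sub, hy]; ring

lemma kex_step (h2 : ∀ x : R, x + x = 0 → x = 0) (g : ℕ → R) (m : ℕ) (hP : KEx g m)
    (hg : ∀ y, g m * y = 0 → y = 0) {Z : Type*} (x : Z → R) (k : Z → ℕ)
    (J : Z → R →+* R) (hx : ∀ w y, x w * y = 0 → y = 0) (hJx : ∀ w, J w (x w) = 0)
    (hJ : ∀ w, ∀ i < m, J w (g i) = g i) (hd : ∀ w f, x w ∣ f - J w f)
    (hgd : ∀ w, x w ^ k w ∣ g m)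
    (hA : ∀ f, (∀ w, x w ^ k w ∣ f) → g m ∣ f)
    (hB : ∀ q : Z → R, ∃ f, ∀ w, x w ^ k w ∣ f - q w) : KEx g (m + 1) := by
  intro F hF0 hF
  have e1 : ∀ S ⊆ range m, kio g m F S = - (g m * F (insert m S)) := fun S hS => by
    have := hF S (hS.trans (Finset.range_mono (by omega)))
    rw [kio_succ g m F S hS] at this
    exact eq_neg_of_add_eq_zero_left this
  have hloc := fun w => kex_dev h2 g m hP (x w) (hx w) (J w) (hJx w) (hJ w) (hd w) (k w) F hF0
    (fun S hS => by rw [e1 S hS]; exact (dvd_neg.2 ((hgd w).mul_right _)))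
  choose Hw hHb hHw using hloc
  choose H' hH' using fun S => hB (fun w => Hw w S)
  let H : Finset ℕ → R := fun S => if S.card = 1 then 0 else H' S
  have hHb0 : ∀ b, H {b} = 0 := fun b => by simp [H]
  have hHd : ∀ S w, x w ^ k w ∣ H S - Hw w S := by
    intro S w
    by_cases hc : S.card = 1
    · obtain ⟨b, rfl⟩ := Finset.card_eq_one.1 hc
      simp [hHb0, hHb]
    · simp only [H, hc, if_false]; exact hH' S w
  have hdiv : ∀ S, ∃ y, S ⊆ range m → F S - kio g m H S = g m * y := by
    intro S
    by_cases hS : S ⊆ range m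
    · obtain ⟨y, hy⟩ := hA (F S - kio g m H S) (fun w => by
        have : F S - kio g m H S = (F S - kio g m (Hw w) S)
            - kio g m (fun S => H S - Hw w S) S := by rw [kio_sub]; ring
        rw [this]
        refine dvd_sub (hHw w S hS) ?_
        exact Finset.dvd_sum fun b _ => ((hHd _ w).mul_left _).mul_right _)
      exact ⟨y, fun _ => hy⟩
    · exact ⟨0, fun h => absurd h hS⟩
  choose K hK using hdiv
  have hK0 : K ∅ = 0 := by
    apply hg
    rw [← hK ∅ (by simp), hF0, kio_empty g m H hHb0, sub_zero]
  have hK2 : ∀ S ⊆ range m, F (insert m S) = - kio g m K S := fun S hS => by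
    have e : g m * kio g m K S = kio g m F S := by
      rw [← kio_mul, ← kio_congr g hS hK, kio_sub, kio_kio h2, sub_zero]
    have : g m * (F (insert m S) + kio g m K S) = 0 := by
      rw [mul_add, e, e1 S hS]; ring
    exact eq_neg_of_add_eq_zero_left (hg _ this)
  let G : Finset ℕ → R := fun S => if m ∈ S then K (S.erase m) else H S
  have hG1 : ∀ S ⊆ range m, G S = H S := fun S hS => by
    have hm : m ∉ S := fun h => by simpa using hS h
    simp [G, hm]
  have hG2 : ∀ S ⊆ range m, G (insert m S) = K S := fun S hS => by
    have hm : m ∉ S := fun h => by simpa using hS h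
    simp [G, hm]
  refine ⟨G, fun b => ?_, fun S hS => ?_⟩
  · by_cases hb : b = m
    · subst hb; simp [G, hK0]
    · have : m ≠ b := fun h => hb h.symm
      simp [G, this, hHb0]
  · by_cases hm : m ∈ S
    · have hS' : S.erase m ⊆ range m := by
        intro b hb
        have h1 := Finset.mem_erase.1 hb
        have h2 := Finset.mem_range.1 (hS h1.2)
        exact Finset.mem_range.2 (by omega)
      rw [← Finset.insert_erase hm, kio_succ_insert g m G _ hS', hK2 _ hS',
        kio_congr g hS' hG2]
    · have hS' : S ⊆ range m := by
        intro b hb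
        have h2 := Finset.mem_range.1 (hS hb)
        have : b ≠ m := fun h => hm (h ▸ hb)
        exact Finset.mem_range.2 (by omega)
      rw [kio_succ g m G S hS', hG2 S hS', kio_congr g hS' hG1, ← hK S hS']; ring

lemma kex_zero (g : ℕ → R) : KEx g 0 := by
  intro F hF _
  refine ⟨fun _ => 0, by simp, fun S hS => ?_⟩
  have : S = ∅ := by simpa using hS
  subst this
  simp [kio, hF]
end

lemma iso_zero {A : Set ℂ} (hA : IsOpen A) (hAc : IsPreconnected A) {g : ℂ → ℂ}
    (hg : DifferentiableOn ℂ g A) (hg0 : ∃ z ∈ A, g z ≠ 0) :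
    ∀ w ∈ A, ∀ᶠ t in nhdsWithin w {w}ᶜ, g t ≠ 0 := by
  intro w hw
  by_contra hcon
  obtain ⟨z, hz, hgz⟩ := hg0
  refine hgz ((hg.analyticOnNhd hA).eqOn_zero_of_preconnected_of_frequently_eq_zero hAc hw ?_ hz)
  intro h
  exact hcon h

lemma exists_order {A : Set ℂ} (hA : IsOpen A) {g : ℂ → ℂ}
    (hg : DifferentiableOn ℂ g A) {w : ℂ} (hw : w ∈ A)
    (hiso : ∀ᶠ t in nhdsWithin w {w}ᶜ, g t ≠ 0) :
    ∃ (m : ℕ) (u : ℂ → ℂ), DifferentiableOn ℂ u A ∧ u w ≠ 0 ∧ ∀ z ∈ A, g z = (z - w) ^ m * u z := by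
  have han : AnalyticAt ℂ g w := hg.analyticAt (hA.mem_nhds hw)
  have hne : ¬ ∀ᶠ z in nhds w, g z = 0 := by
    intro h
    obtain ⟨t, h1, h2⟩ := (hiso.and (h.filter_mono nhdsWithin_le_nhds)).exists
    exact h1 h2
  obtain ⟨m, u₀, hu₀, hu₀w, heq⟩ := han.exists_eventuallyEq_pow_smul_nonzero_iff.2 hne
  let u : ℂ → ℂ := fun z => if z = w then u₀ w else g z / (z - w) ^ m
  refine ⟨m, u, fun z hz => DifferentiableAt.differentiableWithinAt ?_, by simpa [u] using hu₀w, ?_⟩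
  · by_cases h : z = w
    · subst h
      refine hu₀.differentiableAt.congr_of_eventuallyEq ?_
      filter_upwards [heq] with t ht
      by_cases h : t = z
      · simp [u, h]
      · simp only [u, h, if_false, ht, smul_eq_mul]
        field_simp [sub_ne_zero.2 h]
    · have hev : u =ᶠ[nhds z] fun z => g z / (z - w) ^ m := by
        filter_upwards [isOpen_ne.mem_nhds h] with t ht
        simp [u, show t ≠ w from ht]
      refine DifferentiableAt.congr_of_eventuallyEq ?_ hev
      exact (hg.differentiableAt (hA.mem_nhds hz)).fun_div (by fun_prop)
        (pow_ne_zero _ (sub_ne_zero.2 h))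
  · intro z hz
    by_cases h : z = w
    · subst h
      have := heq.self_of_nhds
      simpa [u] using this
    · simp only [u, h, if_false]
      field_simp [sub_ne_zero.2 h]

lemma local_div {A : Set ℂ} (hA : IsOpen A) {N : ℕ} (k : Fin N) {d : ℂ → ℂ}
    (hd : DifferentiableOn ℂ d A) (hiso : ∀ w ∈ A, ∀ᶠ t in nhdsWithin w {w}ᶜ, d t ≠ 0)
    {f : (Fin N → ℂ) → ℂ} (hf : DifferentiableOn ℂ f (pA A N)) (h₀ : ℂ → (Fin N → ℂ) → ℂ)
    (hh : ∀ z₀ ∈ pA A N, d (z₀ k) = 0 → DifferentiableAt ℂ (h₀ (z₀ k)) z₀ ∧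
      ∀ᶠ z in nhds z₀, f z = d (z k) * h₀ (z₀ k) z) :
    ∃ h : (Fin N → ℂ) → ℂ, DifferentiableOn ℂ h (pA A N) ∧ ∀ z ∈ pA A N, f z = d (z k) * h z := by
  have hop := pA_open hA N
  let h : (Fin N → ℂ) → ℂ := fun z => if d (z k) = 0 then h₀ (z k) z else f z / d (z k)
  have hdk : DifferentiableOn ℂ (fun z : Fin N → ℂ => d (z k)) (pA A N) :=
    hd.comp (by fun_prop) (fun z hz => hz k)
  refine ⟨h, fun z₀ hz₀ => DifferentiableAt.differentiableWithinAt ?_, fun z hz => ?_⟩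
  · by_cases h0 : d (z₀ k) = 0
    · obtain ⟨h1, h2⟩ := hh z₀ hz₀ h0
      refine h1.congr_of_eventuallyEq ?_
      have h3 := (continuous_apply k).continuousAt.tendsto.eventually
        (eventually_nhdsWithin_iff.1 (hiso (z₀ k) (hz₀ k)))
      filter_upwards [h2, h3] with z hz2 hz3
      by_cases hzk : z k = z₀ k
      · simp [h, hzk, h0]
      · have := hz3 hzk
        simp only [h, this, if_false, hz2]
        field_simp
    · have hev : h =ᶠ[nhds z₀] fun z => f z * (d (z k))⁻¹ := by
        have := (hdk.continuousOn.continuousAt (hop.mem_nhds hz₀)).eventually_ne h0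
        filter_upwards [this] with z hz
        simp [h, hz, div_eq_mul_inv]
      refine DifferentiableAt.congr_of_eventuallyEq ?_ hev
      exact (hf.differentiableAt (hop.mem_nhds hz₀)).fun_mul
        (DifferentiableAt.fun_inv (hdk.differentiableAt (hop.mem_nhds hz₀)) h0)
  · by_cases h0 : d (z k) = 0
    · have := (hh z hz h0).2.self_of_nhds
      rw [this, h0]; simp
    · simp only [h, h0, if_false]
      field_simp

/-- exhaustion data -/
structure Exh (A : Set ℂ) (K : ℕ → Set ℂ) : Prop where
  cpt : ∀ j, IsCompact (K j)
  sub : ∀ j, K j ⊆ A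
  mono : Monotone K
  nhd : ∀ z ∈ A, ∃ j, K j ∈ nhds z
  peak : ∀ w ∈ A, ∀ j, w ∉ K j → ∃ e : ℂ → ℂ, DifferentiableOn ℂ e A ∧ e w = 1 ∧
    ∃ c : ℝ, 0 ≤ c ∧ c < 1 ∧ ∀ z ∈ K j, ‖e z‖ ≤ c

lemma Exh.finite {A : Set ℂ} {K : ℕ → Set ℂ} (hK : Exh A K) {g : ℂ → ℂ}
    (hiso : ∀ w ∈ A, ∀ᶠ t in nhdsWithin w {w}ᶜ, g t ≠ 0) (j : ℕ) :
    {w | w ∈ K j ∧ g w = 0}.Finite := by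
  by_contra hinf
  obtain ⟨x, hx, hacc⟩ := Set.Infinite.exists_accPt_of_subset_isCompact hinf (hK.cpt j)
    (fun w hw => hw.1)
  rw [accPt_iff_frequently_nhdsNE] at hacc
  exact hacc ((hiso x (hK.sub j hx)).mono fun t ht h => ht h.2)

lemma Exh.countable {A : Set ℂ} {K : ℕ → Set ℂ} (hK : Exh A K) {g : ℂ → ℂ}
    (hiso : ∀ w ∈ A, ∀ᶠ t in nhdsWithin w {w}ᶜ, g t ≠ 0) :
    {w | w ∈ A ∧ g w = 0}.Countable := by
  refine (Set.countable_iUnion fun j => (hK.finite hiso j).countable).mono ?_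
  rintro w ⟨hw, h⟩
  obtain ⟨j, hj⟩ := hK.nhd w hw
  exact Set.mem_iUnion.2 ⟨j, mem_of_mem_nhds hj, h⟩

lemma div_one_var {A : Set ℂ} (hA : IsOpen A) {φ : ℂ → ℂ} (hφ : DifferentiableOn ℂ φ A) {w : ℂ}
    (hw : w ∈ A) (h0 : φ w = 0) :
    ∃ ψ : ℂ → ℂ, DifferentiableOn ℂ ψ A ∧ ∀ z ∈ A, φ z = (z - w) * ψ z := by
  refine ⟨dslope φ w, (Complex.differentiableOn_dslope (hA.mem_nhds hw)).2 hφ, fun z _ => ?_⟩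
  have := sub_smul_dslope φ w z
  rw [h0, sub_zero, smul_eq_mul] at this
  exact this.symm

lemma exists_pw {A : Set ℂ} (hA : IsOpen A) {K : ℕ → Set ℂ} (hK : Exh A K) {N : ℕ} (k : Fin N)
    {w : ℂ} (hw : w ∈ A) (m : ℕ) {u : ℂ → ℂ} (hu : DifferentiableOn ℂ u A) (huw : u w ≠ 0)
    {q : (Fin N → ℂ) → ℂ} (hq : DifferentiableOn ℂ q (pA A N)) {D : ℝ} (hD : 0 < D) :
    ∃ p a : ℂ → ℂ, DifferentiableOn ℂ p A ∧ DifferentiableOn ℂ a A ∧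
      (∀ z ∈ A, u z * p z = 1 + (z - w) ^ m * a z) ∧
      ∀ j, w ∉ K j → ∀ z ∈ pA (K j) N, ‖p (z k) / (z k - w) ^ m * q z‖ ≤ D := by
  let r : ℂ → ℂ := fun z => (u w)⁻¹ * ∑ i ∈ range m, (1 - u z / u w) ^ i
  have hr : DifferentiableOn ℂ r A := by
    have : DifferentiableOn ℂ (fun z => 1 - u z / u w) A := by fun_prop
    fun_prop
  have hur : ∀ z, u z * r z = 1 - (1 - u z / u w) ^ m := by
    intro z
    have := mul_neg_geom_sum (1 - u z / u w) m
    rw [← this]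
    simp only [r]
    field_simp
    ring
  have hE : ∃ e : ℂ → ℂ, DifferentiableOn ℂ e A ∧ e w = 1 ∧ ∀ j, w ∉ K j → ∀ z ∈ pA (K j) N,
      ‖r (z k) * (1 - (1 - e (z k)) ^ m) / (z k - w) ^ m * q z‖ ≤ D := by
    by_cases h0 : w ∈ K 0
    · exact ⟨fun _ => 1, by fun_prop, rfl, fun j hj => absurd (hK.mono (Nat.zero_le j) h0) hj⟩
    · have hex : ∃ j, w ∈ K j := by
        obtain ⟨j, hj⟩ := hK.nhd w hw
        exact ⟨j, mem_of_mem_nhds hj⟩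
      classical
      obtain ⟨J, hJ⟩ : ∃ J, Nat.find hex = J + 1 :=
        Nat.exists_eq_succ_of_ne_zero (fun h => h0 (h ▸ Nat.find_spec hex))
      have hwJ : w ∉ K J := Nat.find_min hex (by omega)
      have hle : ∀ j, w ∉ K j → j ≤ J := by
        intro j hj
        by_contra hlt
        exact hj (hK.mono (by omega : J + 1 ≤ j) (hJ ▸ Nat.find_spec hex))
      obtain ⟨e, he, hew, c, hc0, hc1, hec⟩ := hK.peak w hw J hwJ
      have hcpt : IsCompact (pA (K J) N) := by
        have : pA (K J) N = Set.pi Set.univ (fun _ => K J) := by ext; simp [pA]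
        rw [this]; exact isCompact_univ_pi fun _ => hK.cpt J
      have hsub : pA (K J) N ⊆ pA A N := fun z hz i => hK.sub J (hz i)
      have hcont : ContinuousOn (fun z : Fin N → ℂ => r (z k) / (z k - w) ^ m * q z)
          (pA (K J) N) := by
        refine ContinuousOn.mul (ContinuousOn.div ?_ (by fun_prop) ?_) (hq.continuousOn.mono hsub)
        · exact hr.continuousOn.comp (by fun_prop) (fun z hz => hK.sub J (hz k))
        · intro z hz
          refine pow_ne_zero _ (sub_ne_zero.2 fun h => hwJ (h ▸ hz k))
      obtain ⟨C, hC⟩ := hcpt.exists_bound_of_continuousOn hcont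
      have hlim : Filter.Tendsto (fun x : ℂ => (1 - (1 - x) ^ m)) (nhds 0) (nhds 0) := by
        have : Continuous fun x : ℂ => (1 - (1 - x) ^ m) := by fun_prop
        have h := this.tendsto 0
        simpa using h
      have hη : 0 < D / (|C| + 1) := by positivity
      obtain ⟨η, hη0, hη1⟩ := Metric.tendsto_nhds_nhds.1 hlim _ hη
      obtain ⟨s, hs⟩ := exists_pow_lt_of_lt_one hη0 hc1
      refine ⟨fun z => e z ^ s, by fun_prop, by simp [hew], fun j hj z hz => ?_⟩
      have hz' : z ∈ pA (K J) N := fun i => hK.mono (hle j hj) (hz i)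
      have h1 : ‖1 - (1 - e (z k) ^ s) ^ m‖ < D / (|C| + 1) := by
        have := @hη1 (e (z k) ^ s) (by
          rw [dist_zero_right, norm_pow]
          exact (pow_le_pow_left₀ (norm_nonneg _) (hec _ (hz' k)) s).trans_lt hs)
        simpa [dist_zero_right] using this
      have h2 := hC z hz'
      have h3 : r (z k) * (1 - (1 - e (z k) ^ s) ^ m) / (z k - w) ^ m * q z =
        (r (z k) / (z k - w) ^ m * q z) * (1 - (1 - e (z k) ^ s) ^ m) := by ring
      rw [h3, norm_mul]
      calc _ ≤ (|C| + 1) * (D / (|C| + 1)) := by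
            refine mul_le_mul ?_ h1.le (norm_nonneg _) (by positivity)
            have := le_abs_self C
            linarith
        _ = D := by field_simp
  obtain ⟨e, he, hew, hbd⟩ := hE
  obtain ⟨α, hα, hα'⟩ := div_one_var hA (φ := fun z => 1 - u z / u w) (by fun_prop) hw
    (by field_simp; simp)
  obtain ⟨β, hβ, hβ'⟩ := div_one_var hA (φ := fun z => 1 - e z) (by fun_prop) hw
    (by simp [hew])
  refine ⟨fun z => r z * (1 - (1 - e z) ^ m),
    fun z => -(α z ^ m + β z ^ m - (z - w) ^ m * (α z ^ m * β z ^ m)), by fun_prop, by fun_prop,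
    fun z hz => ?_, hbd⟩
  have : u z * (r z * (1 - (1 - e z) ^ m)) = (u z * r z) * (1 - (1 - e z) ^ m) := by ring
  rw [this, hur]
  have e1 := hα' z hz
  have e2 := hβ' z hz
  rw [e1, e2, mul_pow, mul_pow]
  ring

lemma interp {A : Set ℂ} (hA : IsOpen A) {K : ℕ → Set ℂ} (hK : Exh A K) {N : ℕ} (k : Fin N)
    {g : ℂ → ℂ} (hg : DifferentiableOn ℂ g A)
    (hiso : ∀ w ∈ A, ∀ᶠ t in nhdsWithin w {w}ᶜ, g t ≠ 0)
    (m : {w // w ∈ A ∧ g w = 0} → ℕ) (u : {w // w ∈ A ∧ g w = 0} → ℂ → ℂ)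
    (hu : ∀ w, DifferentiableOn ℂ (u w) A) (huw : ∀ w, u w w.1 ≠ 0)
    (hgu : ∀ w, ∀ z ∈ A, g z = (z - w.1) ^ m w * u w z)
    (q : {w // w ∈ A ∧ g w = 0} → (Fin N → ℂ) → ℂ)
    (hq : ∀ w, DifferentiableOn ℂ (q w) (pA A N)) :
    ∃ f : (Fin N → ℂ) → ℂ, DifferentiableOn ℂ f (pA A N) ∧ ∀ w,
      ∃ h : (Fin N → ℂ) → ℂ, DifferentiableOn ℂ h (pA A N) ∧
        ∀ z ∈ pA A N, f z - q w z = (z k - w.1) ^ m w * h z := by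
  classical
  have hop := pA_open hA N
  have : Countable {w // w ∈ A ∧ g w = 0} := (hK.countable hiso).to_subtype
  obtain ⟨c, hc⟩ := exists_injective_nat {w // w ∈ A ∧ g w = 0}
  have hsum : Summable fun w => ((1 : ℝ) / 2) ^ c w := summable_geometric_two.comp_injective hc
  choose p a hp ha hpa hbd using fun w => exists_pw hA hK k w.2.1 (m w) (hu w) (huw w) (hq w)
    (by positivity : (0 : ℝ) < (1 / 2) ^ c w)
  let P : {w // w ∈ A ∧ g w = 0} → (Fin N → ℂ) → ℂ := fun w z =>
    p w (z k) / (z k - w.1) ^ m w * q w z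
  let T : ℂ → (Fin N → ℂ) → ℂ := fun w₀ z => ∑' w, if w.1 = w₀ then 0 else P w z
  let f : (Fin N → ℂ) → ℂ := fun z => ∑' w, u w (z k) * p w (z k) * q w z
  -- local analysis
  have hloc : ∀ z₀ ∈ pA A N, DifferentiableAt ℂ (T (z₀ k)) z₀ ∧ ∀ᶠ z in nhds z₀,
      (Summable fun w => if w.1 = z₀ k then 0 else P w z) ∧
      ∀ w : {w // w ∈ A ∧ g w = 0}, w.1 ≠ z₀ k → z k ≠ w.1 := by
    intro z₀ hz₀
    have h1 := (continuous_apply k).continuousAt.tendsto.eventually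
        (eventually_nhdsWithin_iff.1 (hiso (z₀ k) (hz₀ k)))
    obtain ⟨j, hj⟩ : ∃ j, ∀ i, K j ∈ nhds (z₀ i) := by
      have : ∀ i, ∀ᶠ j in Filter.atTop, K j ∈ nhds (z₀ i) := fun i => by
        obtain ⟨j, hj⟩ := hK.nhd _ (hz₀ i)
        filter_upwards [Filter.eventually_ge_atTop j] with j' hj'
        exact Filter.mem_of_superset hj (hK.mono hj')
      exact (Filter.eventually_all.2 this).exists
    have h2 : ∀ᶠ z in nhds z₀, z ∈ pA (K j) N := by
      refine Filter.eventually_all.2 fun i => ?_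
      exact (continuous_apply i).continuousAt.eventually_mem (hj i)
    obtain ⟨ρ, hρ, hball⟩ := Metric.nhds_basis_closedBall.eventually_iff.1 (h1.and h2)
    have hne : ∀ z ∈ Metric.closedBall z₀ ρ, ∀ w : {w // w ∈ A ∧ g w = 0}, w.1 ≠ z₀ k →
        z k ≠ w.1 := by
      intro z hz w hw h
      exact (hball hz).1 (h ▸ hw) (h ▸ w.2.2)
    have hKball : ∀ z ∈ Metric.closedBall z₀ ρ, z ∈ pA (K j) N := fun z hz => (hball hz).2
    have hAball : Metric.closedBall z₀ ρ ⊆ pA A N := fun z hz i => hK.sub j (hKball z hz i)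
    have hPd : ∀ w : {w // w ∈ A ∧ g w = 0}, w.1 ≠ z₀ k →
        DifferentiableOn ℂ (P w) (Metric.closedBall z₀ ρ) := by
      intro w hw
      refine DifferentiableOn.fun_mul ?_ ((hq w).mono hAball)
      simp only [div_eq_mul_inv]
      refine DifferentiableOn.fun_mul ((hp w).comp (by fun_prop) (fun z hz => hAball hz k)) ?_
      exact DifferentiableOn.fun_inv (by fun_prop)
        (fun z hz => pow_ne_zero _ (sub_ne_zero.2 (hne z hz w hw)))
    have hC : ∀ w : {w // w ∈ A ∧ g w = 0}, ∃ C : ℝ, w.1 ≠ z₀ k →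
        ∀ z ∈ Metric.closedBall z₀ ρ, ‖P w z‖ ≤ C := by
      intro w
      by_cases hw : w.1 = z₀ k
      · exact ⟨0, fun h => absurd hw h⟩
      · obtain ⟨C, hC⟩ := (isCompact_closedBall z₀ ρ).exists_bound_of_continuousOn
          (hPd w hw).continuousOn
        exact ⟨C, fun _ => hC⟩
    choose C hC using hC
    let b : {w // w ∈ A ∧ g w = 0} → ℝ := fun w =>
      (1 / 2) ^ c w + if w.1 ∈ K j then |C w| else 0
    have hb : Summable b := by
      refine hsum.add (summable_of_hasFiniteSupport ?_)
      have hfin : {w : {w // w ∈ A ∧ g w = 0} | w.1 ∈ K j}.Finite := by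
        refine Set.Finite.of_finite_image (f := Subtype.val) ((hK.finite hiso j).subset ?_)
          Subtype.val_injective.injOn
        rintro _ ⟨w, hw, rfl⟩
        exact ⟨hw, w.2.2⟩
      refine hfin.subset fun w hw => ?_
      by_contra h
      have h' : ¬ w.1 ∈ K j := h
      simp [h'] at hw
    have hbb : ∀ w, ∀ z ∈ Metric.closedBall z₀ ρ, ‖if w.1 = z₀ k then 0 else P w z‖ ≤ b w := by
      intro w z hz
      have hpos : (0 : ℝ) < (1 / 2) ^ c w := by positivity
      by_cases hw : w.1 = z₀ k
      · rw [if_pos hw, norm_zero]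
        simp only [b]
        split_ifs <;> positivity
      · rw [if_neg hw]
        simp only [b]
        split_ifs with hwK
        · have := hC w hw z hz
          have := le_abs_self (C w)
          linarith
        · have := hbd w j hwK z (hKball z hz)
          simpa [P] using this
    refine ⟨diff_tsum hρ hb (fun w => ?_) (fun w z hz => hbb w z (Metric.ball_subset_closedBall hz)),
      ?_⟩
    · by_cases hw : w.1 = z₀ k
      · simp [hw]
      · simp only [hw, if_false]
        exact (hPd w hw).mono Metric.ball_subset_closedBall
    · filter_upwards [Metric.closedBall_mem_nhds z₀ hρ] with z hz
      exact ⟨Summable.of_norm_bounded hb (fun w => hbb w z hz), hne z hz⟩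
  -- the terms
  have hterm : ∀ z ∈ pA A N, ∀ w : {w // w ∈ A ∧ g w = 0}, z k ≠ w.1 →
      u w (z k) * p w (z k) * q w z = g (z k) * P w z := by
    intro z hz w hne
    rw [hgu w (z k) (hz k)]
    simp only [P]
    have := sub_ne_zero.2 hne
    field_simp
  have hform1 : ∀ z₀ ∈ pA A N, g (z₀ k) ≠ 0 → ∀ᶠ z in nhds z₀, f z = g (z k) * T (z₀ k) z := by
    intro z₀ hz₀ hg0
    filter_upwards [(hloc z₀ hz₀).2, hop.mem_nhds hz₀] with z ⟨hs, hne⟩ hz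
    simp only [f, T]
    rw [← tsum_mul_left]
    refine tsum_congr fun w => ?_
    have hw : w.1 ≠ z₀ k := fun h => hg0 (h ▸ w.2.2)
    rw [if_neg hw, hterm z hz w (hne w hw)]
  have hform2 : ∀ z₀ ∈ pA A N, ∀ w : {w // w ∈ A ∧ g w = 0}, z₀ k = w.1 → ∀ᶠ z in nhds z₀,
      f z = u w (z k) * p w (z k) * q w z + g (z k) * T w.1 z := by
    intro z₀ hz₀ w hw
    filter_upwards [(hloc z₀ hz₀).2, hop.mem_nhds hz₀] with z ⟨hs, hne⟩ hz
    rw [hw] at hs hne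
    have heq : ∀ w' : {w // w ∈ A ∧ g w = 0},
        (if w' = w then 0 else u w' (z k) * p w' (z k) * q w' z) =
        g (z k) * (if w'.1 = w.1 then 0 else P w' z) := by
      intro w'
      by_cases h : w' = w
      · simp [h]
      · have h' : w'.1 ≠ w.1 := fun e => h (Subtype.ext e)
        rw [if_neg h, if_neg h', hterm z hz w' (hne w' h')]
    have hs' : Summable fun w' => if w' = w then 0 else u w' (z k) * p w' (z k) * q w' z := by
      simp only [heq]
      exact hs.mul_left _
    have hs'' : Summable fun w' => u w' (z k) * p w' (z k) * q w' z := by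
      have h1 : Summable fun w' => if w' = w then u w (z k) * p w (z k) * q w z else 0 :=
        (hasSum_ite_eq w _).summable
      refine (hs'.add h1).congr fun w' => ?_
      by_cases h : w' = w
      · simp [h]
      · simp [h]
    simp only [f, T]
    rw [hs''.tsum_eq_add_tsum_ite w, ← tsum_mul_left]
    congr 1
    refine tsum_congr fun w' => ?_
    rw [← heq]
  have hgk : DifferentiableOn ℂ (fun z : Fin N → ℂ => g (z k)) (pA A N) :=
    hg.comp (by fun_prop) (fun z hz => hz k)
  have hcomp : ∀ {φ : ℂ → ℂ}, DifferentiableOn ℂ φ A → ∀ z₀ ∈ pA A N,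
      DifferentiableAt ℂ (fun z : Fin N → ℂ => φ (z k)) z₀ := by
    intro φ hφ z₀ hz₀
    have : DifferentiableOn ℂ (fun z : Fin N → ℂ => φ (z k)) (pA A N) :=
      hφ.comp (by fun_prop) (fun z hz => hz k)
    exact this.differentiableAt (hop.mem_nhds hz₀)
  have hf : DifferentiableOn ℂ f (pA A N) := by
    intro z₀ hz₀
    refine DifferentiableAt.differentiableWithinAt ?_
    by_cases h0 : g (z₀ k) = 0
    · have hT := (hloc z₀ hz₀).1
      refine DifferentiableAt.congr_of_eventuallyEq ?_ (hform2 z₀ hz₀ ⟨z₀ k, hz₀ k, h0⟩ rfl)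
      exact (((hcomp (hu _) z₀ hz₀).fun_mul (hcomp (hp _) z₀ hz₀)).fun_mul
        ((hq _).differentiableAt (hop.mem_nhds hz₀))).fun_add ((hcomp hg z₀ hz₀).fun_mul hT)
    · refine DifferentiableAt.congr_of_eventuallyEq ?_ (hform1 z₀ hz₀ h0)
      exact (hcomp hg z₀ hz₀).fun_mul (hloc z₀ hz₀).1
  refine ⟨f, hf, fun w => ?_⟩
  refine local_div hA k (d := fun t => (t - w.1) ^ m w) (by fun_prop) ?_ (hf.fun_sub (hq w))
    (fun _ z => a w (z k) * q w z + u w (z k) * T w.1 z) ?_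
  · intro v _
    by_cases hv : v = w.1
    · subst hv
      filter_upwards [self_mem_nhdsWithin] with t ht
      exact pow_ne_zero _ (sub_ne_zero.2 ht)
    · have : ∀ᶠ t in nhds v, t ≠ w.1 := isOpen_ne.mem_nhds hv
      filter_upwards [this.filter_mono nhdsWithin_le_nhds] with t ht
      exact pow_ne_zero _ (sub_ne_zero.2 ht)
  · intro z₀ hz₀ hz
    have hz : z₀ k = w.1 := by
      by_contra h
      exact pow_ne_zero _ (sub_ne_zero.2 h) hz
    refine ⟨?_, ?_⟩
    · have hT := (hloc z₀ hz₀).1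
      rw [hz] at hT
      exact ((hcomp (ha w) z₀ hz₀).fun_mul ((hq _).differentiableAt (hop.mem_nhds hz₀))).fun_add
        ((hcomp (hu w) z₀ hz₀).fun_mul hT)
    · filter_upwards [hform2 z₀ hz₀ w hz, hop.mem_nhds hz₀] with z h1 h2
      rw [h1, hpa w (z k) (h2 k), hgu w (z k) (h2 k)]
      ring

/-- The ring of holomorphic functions on the product domain. -/
def HR (A : Set ℂ) (N : ℕ) : Subring (pA A N → ℂ) where
  carrier := {φ | ∃ f : (Fin N → ℂ) → ℂ, DifferentiableOn ℂ f (pA A N) ∧ ∀ z : pA A N, φ z = f z}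
  mul_mem' := by
    rintro _ _ ⟨f, hf, hf'⟩ ⟨h, hh, hh'⟩
    exact ⟨fun z => f z * h z, hf.fun_mul hh, fun z => by simp [hf', hh']⟩
  add_mem' := by
    rintro _ _ ⟨f, hf, hf'⟩ ⟨h, hh, hh'⟩
    exact ⟨fun z => f z + h z, hf.fun_add hh, fun z => by simp [hf', hh']⟩
  neg_mem' := by
    rintro _ ⟨f, hf, hf'⟩
    exact ⟨fun z => - f z, hf.fun_neg, fun z => by simp [hf']⟩
  zero_mem' := ⟨fun _ => 0, by fun_prop, fun _ => rfl⟩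
  one_mem' := ⟨fun _ => 1, by fun_prop, fun _ => rfl⟩

/-- An element of the ring from a holomorphic function. -/
def toR {A : Set ℂ} {N : ℕ} (f : (Fin N → ℂ) → ℂ) (hf : DifferentiableOn ℂ f (pA A N)) : HR A N :=
  ⟨fun z => f z, f, hf, fun _ => rfl⟩

lemma comp_k {A : Set ℂ} {N : ℕ} (k : Fin N) {d : ℂ → ℂ} (hd : DifferentiableOn ℂ d A) :
    DifferentiableOn ℂ (fun z : Fin N → ℂ => d (z k)) (pA A N) :=
  hd.comp (by fun_prop) (fun _ hz => hz k)

/-- A function of one coordinate. -/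
def evR {A : Set ℂ} {N : ℕ} (k : Fin N) (d : ℂ → ℂ) (hd : DifferentiableOn ℂ d A) : HR A N :=
  toR (fun z => d (z k)) (comp_k k hd)

/-- Restriction to a coordinate hyperplane. -/
def JR {A : Set ℂ} {N : ℕ} (k : Fin N) (w : ℂ) (hw : w ∈ A) : HR A N →+* HR A N where
  toFun φ := ⟨fun z => φ.1 ⟨Function.update z.1 k w, pA_update z.2 k hw⟩, by
    obtain ⟨φ, f, hf, hf'⟩ := φ
    refine ⟨fun z => f (Function.update z k w), ?_, fun z => hf' _⟩
    refine hf.comp (Differentiable.differentiableOn ?_) (fun t ht => pA_update ht k hw)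
    exact (diff_update k).comp (by fun_prop : Differentiable ℂ fun z : Fin N → ℂ => (z, w))⟩
  map_one' := rfl
  map_zero' := rfl
  map_mul' _ _ := rfl
  map_add' _ _ := rfl

lemma HR_cancel {A : Set ℂ} (hA : IsOpen A) {N : ℕ} (k : Fin N) {d : ℂ → ℂ}
    (hd : DifferentiableOn ℂ d A)
    (hiso : ∀ w ∈ A, ∀ᶠ t in nhdsWithin w {w}ᶜ, d t ≠ 0) (y : HR A N)
    (h : evR k d hd * y = 0) : y = 0 := by
  obtain ⟨φ, f, hf, hf'⟩ := y
  have h1 : ∀ z ∈ pA A N, d (z k) * f z = 0 := by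
    intro z hz
    have := congrFun (congrArg Subtype.val h) ⟨z, hz⟩
    have h3 : d (z k) * φ ⟨z, hz⟩ = 0 := this
    rwa [hf'] at h3
  refine Subtype.ext (funext fun z => ?_)
  change φ z = 0
  rw [hf']
  obtain ⟨z, hz⟩ := z
  change f z = 0
  have hcont : ContinuousAt (fun t => f (Function.update z k t)) (z k) := by
    have : ContinuousAt f (Function.update z k (z k)) := by
      rw [Function.update_eq_self]
      exact hf.continuousOn.continuousAt ((pA_open hA N).mem_nhds hz)
    exact ContinuousAt.comp (f := fun t => Function.update z k t) this (by fun_prop)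
  have ht : Filter.Tendsto (fun t => f (Function.update z k t)) (nhdsWithin (z k) {z k}ᶜ)
      (nhds (f z)) := by
    have := hcont.tendsto
    rw [Function.update_eq_self] at this
    exact this.mono_left nhdsWithin_le_nhds
  refine tendsto_nhds_unique (ht.congr' ?_) tendsto_const_nhds
  have hmem : ∀ᶠ t in nhdsWithin (z k) {z k}ᶜ, t ∈ A :=
    Filter.Eventually.filter_mono nhdsWithin_le_nhds (hA.mem_nhds (hz k))
  filter_upwards [hiso (z k) (hz k), hmem] with t ht1 ht2
  have := h1 _ (pA_update hz k ht2)
  rw [Function.update_self] at this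
  exact (mul_eq_zero.1 this).resolve_left ht1

lemma iso_sub (w : ℂ) (v : ℂ) : ∀ᶠ t in nhdsWithin v {v}ᶜ, t - w ≠ 0 := by
  by_cases hv : v = w
  · subst hv
    filter_upwards [self_mem_nhdsWithin] with t ht
    exact sub_ne_zero.2 ht
  · have : ∀ᶠ t in nhds v, t ≠ w := isOpen_ne.mem_nhds hv
    filter_upwards [this.filter_mono nhdsWithin_le_nhds] with t ht
    exact sub_ne_zero.2 ht

lemma HR_dvd {A : Set ℂ} {N : ℕ} {d f h : (Fin N → ℂ) → ℂ} (hd : DifferentiableOn ℂ d (pA A N))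
    (φ : HR A N) (hφ : ∀ z : pA A N, φ.1 z = f z)
    (hh : DifferentiableOn ℂ h (pA A N)) (e : ∀ z ∈ pA A N, f z = d z * h z) : toR d hd ∣ φ := by
  refine ⟨toR h hh, Subtype.ext (funext fun z => ?_)⟩
  rw [hφ, e z.1 z.2]
  rfl

/-- The coefficient sequence. -/
noncomputable def gsR {A : Set ℂ} (N : ℕ) (g : ℂ → ℂ) (hg : DifferentiableOn ℂ g A) (b : ℕ) :
    HR A N := if h : b < N then evR ⟨b, h⟩ g hg else 0

lemma HR_two {A : Set ℂ} {N : ℕ} (x : HR A N) (h : x + x = 0) : x = 0 := by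
  refine Subtype.ext (funext fun z => ?_)
  have h1 : x.1 z + x.1 z = 0 := congrFun (congrArg Subtype.val h) z
  change x.1 z = 0
  exact add_self_eq_zero.1 h1

lemma xpow_eq {A : Set ℂ} {N : ℕ} (k : Fin N) (w : ℂ) (m : ℕ) :
    (evR k (fun t => t - w) (by fun_prop) : HR A N) ^ m =
      toR (fun z => (z k - w) ^ m) (by fun_prop) := by
  refine Subtype.ext (funext fun z => ?_)
  rfl

lemma kex_hol {A : Set ℂ} (hA : IsOpen A) (hAc : IsPreconnected A) {K : ℕ → Set ℂ} (hK : Exh A K)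
    {N : ℕ} {g : ℂ → ℂ} (hg : DifferentiableOn ℂ g A) (hg0 : ∃ z ∈ A, g z ≠ 0) (m : ℕ)
    (hm : m ≤ N) : KEx (gsR N g hg) m := by
  have hiso := iso_zero hA hAc hg hg0
  induction m with
  | zero => exact kex_zero _
  | succ m ih =>
    have hmN : m < N := hm
    let k : Fin N := ⟨m, hmN⟩
    have hgm : gsR N g hg m = evR k g hg := by simp [gsR, hmN, k]
    choose μ u hu huw hgu using fun w : {w // w ∈ A ∧ g w = 0} =>
      exists_order hA hg w.2.1 (hiso w.1 w.2.1)
    refine kex_step HR_two (gsR N g hg) m (ih hmN.le) ?_ (Z := {w // w ∈ A ∧ g w = 0})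
      (fun w => evR k (fun t => t - w.1) (by fun_prop)) μ (fun w => JR k w.1 w.2.1)
      (fun w y => HR_cancel hA k _ (fun v _ => iso_sub w.1 v) y) ?_ ?_ ?_ ?_ ?_ ?_
    · rw [hgm]
      exact HR_cancel hA k hg hiso
    · intro w
      refine Subtype.ext (funext fun z => ?_)
      change Function.update z.1 k w.1 k - w.1 = 0
      simp
    · intro w i hi
      have hiN : i < N := by omega
      refine Subtype.ext (funext fun z => ?_)
      simp only [gsR, hiN, dif_pos]
      change g (Function.update z.1 k w.1 ⟨i, hiN⟩) = g (z.1 ⟨i, hiN⟩)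
      rw [Function.update_of_ne]
      simp only [k, ne_eq, Fin.mk.injEq]
      omega
    · intro w φ
      obtain ⟨f, hf, hf'⟩ := (φ - JR k w.1 w.2.1 φ).2
      obtain ⟨h, hh, e⟩ := diff_dslope hA hf k w.2.1 (by
        intro z hz hzk
        rw [← hf' ⟨z, hz⟩]
        change φ.1 ⟨z, hz⟩ - φ.1 ⟨Function.update z k w.1, _⟩ = 0
        rw [sub_eq_zero]
        refine congrArg φ.1 (Subtype.ext ?_)
        change z = Function.update z k w.1
        rw [← hzk, Function.update_eq_self])
      exact HR_dvd _ _ hf' hh e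
    · intro w
      rw [hgm, xpow_eq]
      exact HR_dvd _ _ (fun z => rfl) (comp_k k (hu w)) (fun z hz => hgu w _ (hz k))
    · intro φ hφ
      simp only [xpow_eq] at hφ
      rw [hgm]
      choose y hy using hφ
      have hyr := fun w => (y w).2
      choose h hh hh' using hyr
      obtain ⟨f, hf, hf'⟩ := φ.2
      have hfh : ∀ w : {w // w ∈ A ∧ g w = 0}, ∀ z ∈ pA A N,
          f z = (z k - w.1) ^ μ w * h w z := by
        intro w z hz
        rw [← hf' ⟨z, hz⟩, ← hh' w ⟨z, hz⟩]
        exact congrFun (congrArg Subtype.val (hy w)) ⟨z, hz⟩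
      classical
      obtain ⟨q, hq, e⟩ := local_div hA k hg hiso hf
        (fun w z => if hw : w ∈ A ∧ g w = 0 then h ⟨w, hw⟩ z * (u ⟨w, hw⟩ (z k))⁻¹ else 0) (by
        intro z₀ hz₀ hg0
        have hw : z₀ k ∈ A ∧ g (z₀ k) = 0 := ⟨hz₀ k, hg0⟩
        have hnh := (pA_open hA N).mem_nhds hz₀
        have hud := (comp_k k (hu ⟨z₀ k, hw⟩)).differentiableAt hnh
        simp only [hw, dif_pos, and_self]
        refine ⟨((hh ⟨z₀ k, hw⟩).differentiableAt hnh).fun_mul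
          (DifferentiableAt.fun_inv hud (huw ⟨z₀ k, hw⟩)), ?_⟩
        have hne := hud.continuousAt.eventually_ne (huw ⟨z₀ k, hw⟩)
        filter_upwards [hne, hnh] with z h1 h2
        rw [hfh ⟨z₀ k, hw⟩ z h2, hgu ⟨z₀ k, hw⟩ (z k) (h2 k)]
        field_simp)
      exact HR_dvd _ _ hf' hq e
    · intro q
      have hqr := fun w => (q w).2
      choose q' hq' hqq using hqr
      obtain ⟨f, hf, hfd⟩ := interp hA hK k hg hiso μ u hu huw hgu q' hq'
      refine ⟨toR f hf, fun w => ?_⟩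
      obtain ⟨h, hh, e⟩ := hfd w
      rw [xpow_eq]
      refine HR_dvd _ _ (f := fun z => f z - q' w z) (fun z => ?_) hh e
      rw [← hqq]
      rfl

-- annulus facts
theorem annulus_open (ε : ℝ) : IsOpen (annulus ε) :=
  (isOpen_lt continuous_const continuous_norm).inter (isOpen_lt continuous_norm continuous_const)

theorem annulus_preconn (ε : ℝ) : IsPreconnected (annulus ε) := by
  have hc : Convex ℝ ((Set.Ioo (1 - ε) (1 + ε) ∩ Set.Ici 0) ×ˢ (Set.univ : Set ℝ)) :=
    ((convex_Ioo _ _).inter (convex_Ici _)).prod convex_univ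
  have h2 := hc.isPreconnected.image (fun p : ℝ × ℝ => (p.1 : ℂ) * Complex.exp (p.2 * Complex.I))
    (by fun_prop)
  convert h2 using 1
  ext z
  simp only [annulus, Set.mem_ofPred_eq, Set.mem_image, Set.mem_prod, Set.mem_inter_iff,
    Set.mem_Ioo, Set.mem_Ici, Set.mem_univ, and_true, Prod.exists]
  constructor
  · intro h
    exact ⟨‖z‖, z.arg, ⟨h, norm_nonneg _⟩, Complex.norm_mul_exp_arg_mul_I z⟩
  · rintro ⟨r, t, ⟨h, h0⟩, rfl⟩
    rw [norm_mul, Complex.norm_exp_ofReal_mul_I, Complex.norm_real, mul_one, Real.norm_of_nonneg h0]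
    exact h

theorem annulus_exh_aux (ε d : ℝ) (hd : 0 < d) (hd1 : d < ε)
    (h0 : ε ≤ 1 ∨ 1 - ε + d ≤ 0) :
    Exh (annulus ε) (fun j : ℕ => {z : ℂ | 1 - ε + d / (j + 1) ≤ ‖z‖ ∧ ‖z‖ ≤ 1 + ε - d / (j + 1)}) where
  cpt j := by
    refine Metric.isCompact_of_isClosed_isBounded ?_ ?_
    · exact (isClosed_le continuous_const continuous_norm).inter
        (isClosed_le continuous_norm continuous_const)
    · refine (Metric.isBounded_closedBall (x := (0 : ℂ)) (r := 1 + ε - d / (j + 1))).subset ?_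
      intro z hz
      simpa using hz.2
  sub j := by
    intro z hz
    have : 0 < d / ((j : ℝ) + 1) := by positivity
    exact ⟨by linarith [hz.1], by linarith [hz.2]⟩
  mono := by
    intro i j hij z hz
    have : d / ((j : ℝ) + 1) ≤ d / ((i : ℝ) + 1) := by gcongr
    exact ⟨by linarith [hz.1], by linarith [hz.2]⟩
  nhd := by
    intro z hz
    obtain ⟨j, hj⟩ : ∃ j : ℕ, d / ((j : ℝ) + 1) < min (‖z‖ - (1 - ε)) (1 + ε - ‖z‖) := by
      have hp : 0 < min (‖z‖ - (1 - ε)) (1 + ε - ‖z‖) :=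
        lt_min (by linarith [hz.1]) (by linarith [hz.2])
      obtain ⟨j, hj⟩ := exists_nat_gt (d / min (‖z‖ - (1 - ε)) (1 + ε - ‖z‖))
      refine ⟨j, ?_⟩
      rw [div_lt_iff₀ hp] at hj
      rw [div_lt_iff₀ (by positivity)]
      nlinarith
    rw [lt_min_iff] at hj
    refine ⟨j, Filter.mem_of_superset (IsOpen.mem_nhds
      (s := {z : ℂ | 1 - ε + d / (j + 1) < ‖z‖ ∧ ‖z‖ < 1 + ε - d / (j + 1)})
      ((isOpen_lt continuous_const continuous_norm).inter
        (isOpen_lt continuous_norm continuous_const)) ?_) ?_⟩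
    · exact ⟨by linarith [hj.1], by linarith [hj.2]⟩
    · intro w hw
      exact ⟨hw.1.le, hw.2.le⟩
  peak := by
    intro w hw j hj
    have hdj : 0 < d / ((j : ℝ) + 1) := by positivity
    have hdj' : d / ((j : ℝ) + 1) ≤ d := div_le_self hd.le (by linarith [(Nat.cast_nonneg j : (0 : ℝ) ≤ j)])
    by_cases h1 : ‖w‖ ≤ 1 + ε - d / (j + 1)
    · have h2 : ‖w‖ < 1 - ε + d / (j + 1) := by
        by_contra h
        exact hj ⟨not_lt.1 h, h1⟩
      have hε1 : ε ≤ 1 := by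
        rcases h0 with h | h
        · exact h
        · linarith [norm_nonneg w]
      have hne : ∀ z ∈ annulus ε, z ≠ 0 := by
        rintro z hz rfl
        have := hz.1
        rw [norm_zero] at this
        linarith
      have hpos : 0 < 1 - ε + d / (j + 1) := (norm_nonneg w).trans_lt h2
      refine ⟨fun z => w / z, ?_, div_self (hne w hw), ‖w‖ / (1 - ε + d / (j + 1)),
        by positivity, (div_lt_one hpos).2 h2, ?_⟩
      · intro z hz
        exact ((differentiableAt_const w).div differentiableAt_id (hne z hz)).differentiableWithinAt
      · intro z hz
        rw [norm_div]
        have := hz.1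
        gcongr
    · push Not at h1
      have hpos : 0 < 1 + ε - d / (j + 1) := by linarith
      have hw0 : 0 < ‖w‖ := hpos.trans h1
      refine ⟨fun z => z / w, ?_, div_self (norm_pos_iff.1 hw0), (1 + ε - d / (j + 1)) / ‖w‖,
        by positivity, (div_lt_one hw0).2 h1, ?_⟩
      · fun_prop
      · intro z hz
        rw [norm_div]
        have := hz.2
        gcongr

theorem annulus_exh (ε : ℝ) (hε : 0 < ε) : ∃ K, Exh (annulus ε) K := by
  by_cases h : ε ≤ 1
  · exact ⟨_, annulus_exh_aux ε (ε / 2) (by linarith) (by linarith) (Or.inl h)⟩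
  · exact ⟨_, annulus_exh_aux ε ((ε - 1) / 2) (by linarith) (by linarith) (Or.inr (by linarith))⟩

-- signs of tuples
/-- The sign of a tuple of naturals. -/
def sg {n : ℕ} (a : Fin n → ℕ) : ℤ := Int.sign (Matrix.vandermonde fun i => (a i : ℤ)).det

/-- The image of a tuple. -/
def img {n M : ℕ} (a : Fin n → Fin M) : Finset ℕ := univ.image fun i => (a i : ℕ)

lemma sg_perm {n : ℕ} (a : Fin n → ℕ) (σ : Equiv.Perm (Fin n)) :
    sg (a ∘ σ) = (Equiv.Perm.sign σ : ℤ) * sg a := by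
  unfold sg
  have : (Matrix.vandermonde fun i => (((a ∘ σ) i : ℕ) : ℤ)) =
      (Matrix.vandermonde fun i => (a i : ℤ)).submatrix σ id := by
    ext i j
    simp [Matrix.vandermonde_apply]
  rw [this, Matrix.det_permute, Int.sign_mul]
  rcases Int.units_eq_one_or (Equiv.Perm.sign σ) with h | h <;> simp [h]

lemma sg_zero {n : ℕ} (a : Fin n → ℕ) (h : ¬ Function.Injective a) : sg a = 0 := by
  unfold sg
  have : (Matrix.vandermonde fun i => (a i : ℤ)).det = 0 := by
    by_contra h0
    rw [← ne_eq, Matrix.det_vandermonde_ne_zero_iff] at h0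
    exact h fun i j hij => h0 (by simp [hij])
  rw [this, Int.sign_zero]

lemma sg_sq {n : ℕ} (a : Fin n → ℕ) (h : Function.Injective a) : sg a * sg a = 1 := by
  have h0 : (Matrix.vandermonde fun i => (a i : ℤ)).det ≠ 0 := by
    rw [Matrix.det_vandermonde_ne_zero_iff]
    exact fun i j hij => h (by simpa using hij)
  unfold sg
  rw [← Int.sign_mul]
  exact Int.sign_eq_one_of_pos (mul_self_pos.2 h0)

lemma sign_prod {ι : Type*} (s : Finset ι) (f : ι → ℤ) :
    Int.sign (∏ i ∈ s, f i) = ∏ i ∈ s, Int.sign (f i) := by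
  classical
  induction s using Finset.induction_on with
  | empty => simp
  | insert i s hi ih => rw [Finset.prod_insert hi, Finset.prod_insert hi, Int.sign_mul, ih]

lemma sg_cons {n : ℕ} (b : ℕ) (a : Fin n → ℕ) :
    sg (Fin.cons b a : Fin (n + 1) → ℕ) =
      (-1) ^ n * (∏ i, Int.sign ((b : ℤ) - (a i : ℤ))) * sg a := by
  unfold sg
  rw [Matrix.det_vandermonde, Matrix.det_vandermonde, Fin.prod_univ_succ, Int.sign_mul]
  simp only [Fin.prod_Ioi_succ, Fin.prod_Ioi_zero, Fin.cons_zero, Fin.cons_succ]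
  rw [sign_prod univ fun i => (a i : ℤ) - b]
  congr 1
  have : ∀ i, Int.sign ((a i : ℤ) - b) = (-1) * Int.sign ((b : ℤ) - a i) := by
    intro i
    rw [← neg_sub, Int.sign_neg]; ring
  simp only [this, Finset.prod_mul_distrib, Finset.prod_const, Finset.card_univ, Fintype.card_fin]

lemma sg_snoc {n : ℕ} (b : ℕ) (a : Fin n → ℕ) :
    sg (Fin.snoc a b : Fin (n + 1) → ℕ) = sg a * ∏ i, Int.sign ((b : ℤ) - (a i : ℤ)) := by
  rw [Fin.snoc_eq_cons_rotate]
  have := sg_perm (Fin.cons b a : Fin (n + 1) → ℕ) (finRotate _)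
  rw [show (fun i => (Fin.cons b a : Fin (n + 1) → ℕ) (finRotate _ i)) =
    (Fin.cons b a : Fin (n + 1) → ℕ) ∘ finRotate _ from rfl, this, sg_cons, sign_finRotate]
  have h : ((-1 : ℤ) ^ n) * (-1) ^ n = 1 := by rw [← mul_pow]; simp
  push_cast
  linear_combination (∏ i, Int.sign ((b : ℤ) - (a i : ℤ))) * sg a * h

lemma prod_ksg {n M : ℕ} (b : ℕ) (a : Fin n → Fin M) (ha : Function.Injective a) :
    ∏ i, Int.sign ((b : ℤ) - ((a i : ℕ) : ℤ)) = ksg b (img a) := by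
  unfold ksg img
  rw [Finset.prod_image]
  exact fun i _ j _ h => ha (Fin.ext h)

lemma img_cons {n M : ℕ} (b : Fin M) (a : Fin n → Fin M) :
    img (Fin.cons b a : Fin (n + 1) → Fin M) = insert (b : ℕ) (img a) := by
  ext x
  simp [img, Fin.exists_fin_succ, eq_comm]

lemma img_snoc {n M : ℕ} (b : Fin M) (a : Fin n → Fin M) :
    img (Fin.snoc a b : Fin (n + 1) → Fin M) = insert (b : ℕ) (img a) := by
  ext x
  simp [img, Fin.exists_fin_succ', eq_comm, or_comm]

lemma img_sub {n M : ℕ} (a : Fin n → Fin M) : img a ⊆ range M := by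
  intro x hx
  obtain ⟨i, -, rfl⟩ := Finset.mem_image.1 hx
  exact Finset.mem_range.2 (a i).2

lemma img_perm {n M : ℕ} (a : Fin n → Fin M) (σ : Equiv.Perm (Fin n)) : img (a ∘ σ) = img a := by
  ext x
  simp only [img, Finset.mem_image, Finset.mem_univ, true_and, Function.comp]
  exact (σ.surjective.exists (p := fun i => (a i : ℕ) = x)).symm

lemma exists_perm {n M : ℕ} {a b : Fin n → Fin M} (ha : Function.Injective a)
    (h : img a = img b) : ∃ σ : Equiv.Perm (Fin n), a = b ∘ σ := by
  have h1 : ∀ i, ∃ j, b j = a i := by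
    intro i
    have : (a i : ℕ) ∈ img b := h ▸ Finset.mem_image_of_mem _ (Finset.mem_univ i)
    obtain ⟨j, -, hj⟩ := Finset.mem_image.1 this
    exact ⟨j, Fin.ext hj⟩
  choose f hf using h1
  have hfi : Function.Injective f := by
    intro i j hij
    apply ha
    rw [← hf i, ← hf j, hij]
  exact ⟨Equiv.ofBijective f (Finite.injective_iff_bijective.1 hfi), funext fun i => (hf i).symm⟩

section
variable {R : Type*} [CommRing R]

lemma alt_perm {n M : ℕ} (F : (Fin n → Fin M) → R)
    (hs : ∀ (a : Fin n → Fin M) (i j : Fin n), i ≠ j → F (a ∘ Equiv.swap i j) = - F a)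
    (σ : Equiv.Perm (Fin n)) : ∀ a, F (a ∘ σ) = ((Equiv.Perm.sign σ : ℤ) : R) * F a := by
  induction σ using Equiv.Perm.swap_induction_on with
  | one => intro a; simp
  | swap_mul f x y hxy ih =>
    intro a
    have : a ∘ (Equiv.swap x y * f : Equiv.Perm (Fin n)) = (a ∘ Equiv.swap x y) ∘ f := rfl
    rw [this, ih, hs a x y hxy, Equiv.Perm.sign_mul, Equiv.Perm.sign_swap hxy]
    simp

lemma alt_hat {n M : ℕ} (F : (Fin n → Fin M) → R)
    (hs : ∀ (a : Fin n → Fin M) (i j : Fin n), i ≠ j → F (a ∘ Equiv.swap i j) = - F a)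
    (hd : ∀ (a : Fin n → Fin M) (i j : Fin n), i ≠ j → a i = a j → F a = 0) :
    ∃ Fh : Finset ℕ → R, (∀ a, F a = ((sg fun i => (a i : ℕ)) : ℤ) * Fh (img a)) ∧
      ∀ S, (¬ ∃ a : Fin n → Fin M, Function.Injective a ∧ img a = S) → Fh S = 0 := by
  classical
  refine ⟨fun S => if h : ∃ a : Fin n → Fin M, Function.Injective a ∧ img a = S then
    ((sg fun i => (h.choose i : ℕ)) : ℤ) * F h.choose else 0, ?_, fun S h => dif_neg h⟩
  intro a
  by_cases ha : Function.Injective a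
  · have h : ∃ b : Fin n → Fin M, Function.Injective b ∧ img b = img a := ⟨a, ha, rfl⟩
    beta_reduce
    rw [dif_pos h]
    obtain ⟨hb, hi⟩ := h.choose_spec
    set b := h.choose
    obtain ⟨σ, hσ⟩ := exists_perm ha hi.symm
    have h1 : (fun i => (a i : ℕ)) = (fun i => (b i : ℕ)) ∘ σ := by rw [hσ]; rfl
    rw [h1, sg_perm]
    have h2 := sg_sq (fun i => (b i : ℕ)) (fun i j hij => hb (Fin.ext hij))
    have h3 : ((sg fun i => (b i : ℕ) : ℤ) : R) * ((sg fun i => (b i : ℕ) : ℤ) : R) = 1 := by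
      rw [← Int.cast_mul, h2, Int.cast_one]
    rw [show F a = _ from hσ ▸ alt_perm F hs σ b]
    push_cast
    linear_combination -((Equiv.Perm.sign σ : ℤ) : R) * F b * h3
  · rw [sg_zero _ fun h => ha fun i j hij => h (by simp [hij])]
    simp only [Function.Injective, not_forall] at ha
    obtain ⟨i, j, hij, hne⟩ := ha
    rw [hd a i j hne hij]
    simp

theorem kex_tuple {g : ℕ → R} {M : ℕ} (hk : KEx g M) (k : ℕ) (F : (Fin (k + 1) → Fin M) → R)
    (hs : ∀ (a : Fin (k + 1) → Fin M) (i j : Fin (k + 1)), i ≠ j → F (a ∘ Equiv.swap i j) = - F a)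
    (hd : ∀ (a : Fin (k + 1) → Fin M) (i j : Fin (k + 1)), i ≠ j → a i = a j → F a = 0)
    (heq : ∀ a : Fin k → Fin M, ∑ b : Fin M, F (Fin.cons b a) * g b = 0) :
    ∃ G : (Fin (k + 2) → Fin M) → R,
      (∀ (a : Fin (k + 2) → Fin M) (i j : Fin (k + 2)), i ≠ j →
        G (a ∘ Equiv.swap i j) = - G a) ∧
      (∀ (a : Fin (k + 2) → Fin M) (i j : Fin (k + 2)), i ≠ j → a i = a j → G a = 0) ∧
      ∀ a : Fin (k + 1) → Fin M, F a = ∑ b : Fin M, G (Fin.snoc a b) * g b := by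
  classical
  obtain ⟨Fh, hF, hF0⟩ := alt_hat F hs hd
  have hemp : Fh ∅ = 0 := by
    refine hF0 _ ?_
    rintro ⟨a, -, h⟩
    have : (a 0 : ℕ) ∈ img a := Finset.mem_image_of_mem _ (Finset.mem_univ 0)
    rw [h] at this
    simp at this
  have hcl : ∀ S ⊆ range M, kio g M Fh S = 0 := by
    intro S hS
    unfold kio
    by_cases hex : ∃ a : Fin k → Fin M, Function.Injective a ∧ img a = S
    · obtain ⟨a, ha, rfl⟩ := hex
      have h2 := sg_sq (fun i => (a i : ℕ)) (fun i j hij => ha (Fin.ext hij))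
      have h3 : ((sg fun i => (a i : ℕ) : ℤ) : R) * ((sg fun i => (a i : ℕ) : ℤ) : R) = 1 := by
        rw [← Int.cast_mul, h2, Int.cast_one]
      have h4 : ((-1 : R) ^ k) * (-1) ^ k = 1 := by rw [← mul_pow]; simp
      rw [Finset.sum_range fun b => (ksg b (img a) : R) * Fh (insert b (img a)) * g b]
      calc _ = ∑ b : Fin M, (-1) ^ k * ((sg fun i => (a i : ℕ) : ℤ) : R) * (F (Fin.cons b a) * g b) := by
            refine Finset.sum_congr rfl fun b _ => ?_
            rw [hF, img_cons]
            have : (fun i => (((Fin.cons b a : Fin (k + 1) → Fin M) i : Fin M) : ℕ)) =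
                (Fin.cons (b : ℕ) (fun i => (a i : ℕ)) : Fin (k + 1) → ℕ) := by
              funext i
              refine Fin.cases ?_ (fun i => ?_) i <;> simp
            rw [this, sg_cons, prod_ksg _ _ ha]
            push_cast
            linear_combination (-(ksg b (img a) : R) * Fh (insert (b : ℕ) (img a)) * g b) * h3
              + (-(ksg b (img a) : R) * Fh (insert (b : ℕ) (img a)) * g b) *
                ((sg fun i => (a i : ℕ) : ℤ) : R) * ((sg fun i => (a i : ℕ) : ℤ) : R) * h4
        _ = 0 := by rw [← Finset.mul_sum, heq, mul_zero]
    · refine Finset.sum_eq_zero fun b _ => ?_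
      by_cases hb : b ∈ S
      · rw [ksg_mem hb]; simp
      · rw [hF0]
        · simp
        rintro ⟨a, ha, hi⟩
        have hbi : b ∈ img a := hi ▸ Finset.mem_insert_self b S
        obtain ⟨i, -, hib⟩ := Finset.mem_image.1 hbi
        refine hex ⟨a ∘ i.succAbove, ha.comp Fin.succAbove_right_injective, ?_⟩
        ext x
        constructor
        · intro hx
          obtain ⟨j, -, rfl⟩ := Finset.mem_image.1 hx
          have h1 : (a (i.succAbove j) : ℕ) ∈ insert b S :=
            hi ▸ Finset.mem_image_of_mem _ (Finset.mem_univ _)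
          refine (Finset.mem_insert.1 h1).resolve_left fun h => ?_
          exact Fin.succAbove_ne i j (ha (Fin.ext (h.trans hib.symm)))
        · intro hx
          have h1 : x ∈ img a := hi ▸ Finset.mem_insert_of_mem hx
          obtain ⟨j, -, rfl⟩ := Finset.mem_image.1 h1
          have hji : j ≠ i := by
            rintro rfl
            exact hb (hib ▸ hx)
          obtain ⟨l, rfl⟩ := Fin.exists_succAbove_eq hji
          exact Finset.mem_image_of_mem (fun i_1 => (((a ∘ i.succAbove) i_1 : Fin M) : ℕ))
            (Finset.mem_univ l)
  obtain ⟨Gh, -, hG⟩ := hk Fh hemp hcl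
  refine ⟨fun a => ((sg fun i => (a i : ℕ) : ℤ) : R) * Gh (img a), ?_, ?_, ?_⟩
  · intro a i j hij
    have := sg_perm (fun i => (a i : ℕ)) (Equiv.swap i j)
    change ((sg ((fun i => (a i : ℕ)) ∘ Equiv.swap i j) : ℤ) : R) * _ = _
    rw [this, img_perm, Equiv.Perm.sign_swap hij]
    simp
  · intro a i j hij h
    change ((sg fun i => (a i : ℕ) : ℤ) : R) * _ = 0
    rw [sg_zero _ fun hi => hij (hi (by simp [h]))]
    simp
  · intro a
    have hsn : ∀ b : Fin M, (fun i => (((Fin.snoc a b : Fin (k + 2) → Fin M) i : Fin M) : ℕ)) =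
        (Fin.snoc (fun i => (a i : ℕ)) (b : ℕ) : Fin (k + 2) → ℕ) := by
      intro b
      funext i
      refine Fin.lastCases ?_ (fun i => ?_) i <;> simp
    rw [hF, hG _ (img_sub a)]
    unfold kio
    rw [Finset.sum_range fun b => (ksg b (img a) : R) * Gh (insert b (img a)) * g b,
      Finset.mul_sum]
    refine Finset.sum_congr rfl fun b _ => ?_
    beta_reduce
    rw [hsn, sg_snoc, img_snoc]
    by_cases ha : Function.Injective a
    · rw [prod_ksg _ _ ha]
      push_cast
      ring
    · rw [sg_zero _ fun h => ha fun i j hij => h (by simp [hij])]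
      simp

end

/-- Appendix B corollary (higher syzygies of the `∇̃`-equation): if a family
`F : (Fin n → Fin M) → ((Fin N → ℂ) → ℂ)` of holomorphic functions, alternating in
its `n` index slots, satisfies `∑ b, F (a with first slot b) z * g (z b) = 0` on the
polyannulus, then `F a z = ∑ b, G (a extended by b) z * g (z b)` for an alternating
family `G` of holomorphic functions with `n + 1` index slots. -/
theorem linear_nabla_equation_syzygy (ε : ℝ) (hε : 0 < ε) (g : ℂ → ℂ)
    (hg : DifferentiableOn ℂ g (annulus ε))
    (hg0 : ∃ z ∈ annulus ε, g z ≠ 0)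
    (n M N : ℕ) (hn : 1 ≤ n) (hM : 1 ≤ M) (hMN : M ≤ N)
    (F : (Fin n → Fin M) → (Fin N → ℂ) → ℂ)
    (hFhol : ∀ a, DifferentiableOn ℂ (F a) (polyAnnulus ε N))
    (hFswap : ∀ (a : Fin n → Fin M) (i j : Fin n), i ≠ j →
      F (a ∘ Equiv.swap i j) = fun z => -F a z)
    (hFdiag : ∀ (a : Fin n → Fin M) (i j : Fin n), i ≠ j → a i = a j → F a = 0)
    (heq : ∀ (a : Fin n → Fin M), ∀ z ∈ polyAnnulus ε N,
      ∑ b : Fin M, F (Function.update a ⟨0, hn⟩ b) z * g (z (Fin.castLE hMN b)) = 0) :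
    ∃ G : (Fin (n + 1) → Fin M) → (Fin N → ℂ) → ℂ,
      (∀ a, DifferentiableOn ℂ (G a) (polyAnnulus ε N)) ∧
      (∀ (a : Fin (n + 1) → Fin M) (i j : Fin (n + 1)), i ≠ j →
        G (a ∘ Equiv.swap i j) = fun z => -G a z) ∧
      (∀ (a : Fin (n + 1) → Fin M) (i j : Fin (n + 1)), i ≠ j → a i = a j → G a = 0) ∧
      (∀ (a : Fin n → Fin M), ∀ z ∈ polyAnnulus ε N,
        F a z = ∑ b : Fin M, G (Fin.snoc a b) z * g (z (Fin.castLE hMN b))) := by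
  obtain ⟨k, rfl⟩ : ∃ k, n = k + 1 := ⟨n - 1, by omega⟩
  obtain ⟨K, hK⟩ := annulus_exh ε hε
  have hk := kex_hol (annulus_open ε) (annulus_preconn ε) hK hg hg0 M hMN
  have hgs : ∀ (b : Fin M) (z : pA (annulus ε) N),
      (gsR N g hg (b : ℕ)).1 z = g (z.1 (Fin.castLE hMN b)) := by
    intro b z
    have hb : (b : ℕ) < N := b.2.trans_le hMN
    simp only [gsR, hb, dif_pos]
    rfl
  have hsum : ∀ (f : Fin M → HR (annulus ε) N) (z : pA (annulus ε) N),
      (∑ b : Fin M, f b * gsR N g hg (b : ℕ) : HR (annulus ε) N).1 z =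
        ∑ b : Fin M, (f b).1 z * g (z.1 (Fin.castLE hMN b)) := by
    intro f z
    have h1 := map_sum ((Pi.evalRingHom (fun _ : pA (annulus ε) N => ℂ) z).comp
      (HR (annulus ε) N).subtype) (fun b : Fin M => f b * gsR N g hg (b : ℕ)) univ
    refine h1.trans (Finset.sum_congr rfl fun b _ => ?_)
    rw [← hgs b z]
    rfl
  obtain ⟨G, hGs, hGd, hGe⟩ := kex_tuple hk k (fun a => toR (A := annulus ε) (F a) (hFhol a))
    (by
      intro a i j hij
      refine Subtype.ext (funext fun z => ?_)
      exact congrFun (hFswap a i j hij) z.1)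
    (by
      intro a i j hij h
      refine Subtype.ext (funext fun z => ?_)
      exact congrFun (hFdiag a i j hij h) z.1)
    (by
      intro a
      refine Subtype.ext (funext fun z => ?_)
      rw [hsum]
      have := heq (Fin.cons ⟨0, hM⟩ a) z.1 z.2
      refine Eq.trans (Finset.sum_congr rfl fun b _ => ?_) this
      have h0 : Function.update (Fin.cons ⟨0, hM⟩ a : Fin (k + 1) → Fin M) ⟨0, hn⟩ b
          = Fin.cons b a := Fin.update_cons_zero _ _ _
      rw [h0]
      rfl)
  classical
  refine ⟨fun a z => if hz : z ∈ pA (annulus ε) N then (G a).1 ⟨z, hz⟩ else 0, ?_, ?_, ?_, ?_⟩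
  · intro a
    obtain ⟨f, hf, hf'⟩ := (G a).2
    refine DifferentiableOn.congr (f := f) hf fun z hz => ?_
    have hz' : z ∈ pA (annulus ε) N := hz
    simp only [hz', dif_pos]
    exact hf' ⟨z, hz'⟩
  · intro a i j hij
    funext z
    by_cases hz : z ∈ pA (annulus ε) N
    · simp only [hz, dif_pos]
      rw [hGs a i j hij]
      rfl
    · simp only [hz, dif_neg, not_false_eq_true, neg_zero]
  · intro a i j hij h
    funext z
    by_cases hz : z ∈ pA (annulus ε) N
    · simp only [hz, dif_pos]
      rw [hGd a i j hij h]
      rfl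
    · simp only [hz, dif_neg, not_false_eq_true]
      rfl
  · intro a z hz
    have hz' : z ∈ pA (annulus ε) N := hz
    simp only [hz', dif_pos]
    have h1 := congrArg (fun φ : HR (annulus ε) N => φ.1 ⟨z, hz'⟩) (hGe a)
    exact h1.trans (hsum _ _)
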